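/- Let K be a compact Hausdorff space having the extension property and let L be a compact Hausdorff scattered space of finite height such that C(K) contains an isometric copy of C(L), i.e., there exists a linear isometric embedding of C(L) into C(K). Then L has the extension property and the Banach space C(L) is isomorphic (as a topological vector space, via a bounded linear bijection with bounded inverse) to c0(I) for some index set I. -/

import Mathlib

open Filter Topology
open scoped ZeroAtInfty

noncomputable section

/-- `E` is an extension operator for the closed set `F` in `K`. -/
def IsExtensionOperator {K : Type*} [TopologicalSpace K] (F : Set K)
    (E : C(↥F, ℝ) →L[ℝ] C(K, ℝ)) : Prop :=
  ∀ f : C(↥F, ℝ), (E f).restrict F = f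

/-- `F` admits an extension operator in `K`. -/
def HasExtensionOperator {K : Type*} [TopologicalSpace K] (F : Set K) : Prop :=
  ∃ E : C(↥F, ℝ) →L[ℝ] C(K, ℝ), IsExtensionOperator F E

/-- `K` has the extension property. -/
def HasExtensionProperty (K : Type*) [TopologicalSpace K] : Prop :=
  ∀ F : Set K, F.Nonempty → IsClosed F → HasExtensionOperator F

/-- `F` admits a regular extension operator in `K`. -/
def HasRegularExtensionOperator {K : Type*} [TopologicalSpace K] [CompactSpace K]
    (F : Set K) (hF : IsClosed F) : Prop :=
  haveI : CompactSpace ↥F := isCompact_iff_compactSpace.mp hF.isCompact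
  ∃ E : C(↥F, ℝ) →L[ℝ] C(K, ℝ), IsExtensionOperator F E ∧ ‖E‖ ≤ 1 ∧ E 1 = 1

/-- `K` has the regular extension property. -/
def HasRegularExtensionProperty (K : Type*) [TopologicalSpace K] [CompactSpace K] : Prop :=
  ∀ F : Set K, F.Nonempty → ∀ hF : IsClosed F, HasRegularExtensionOperator F hF

/-- The submodule `C(K|G)` of `C(K, ℝ)` of functions vanishing on `G`. -/
def vanishingSubmodule {K : Type*} [TopologicalSpace K] (G : Set K) :
    Submodule ℝ C(K, ℝ) where
  carrier := {f | ∀ x ∈ G, f x = 0}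
  add_mem' := by intro f g hf hg x hx; simp [hf x hx, hg x hx]
  zero_mem' := by intro x hx; simp
  smul_mem' := by intro c f hf x hx; simp [hf x hx]

/-- The canonical basis vector of `c₀(I)`: the characteristic function of `{i}`. -/
def c0Single {I : Type*} [TopologicalSpace I] [DiscreteTopology I] (i : I) : C₀(I, ℝ) :=
  letI := Classical.decEq I
  { toFun := fun j => if j = i then (1 : ℝ) else 0
    continuous_toFun := continuous_of_discreteTopology
    zero_at_infty' := by
      have h : (fun j => if j = i then (1 : ℝ) else 0) =ᶠ[Filter.cocompact I] (fun _ => 0) := by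
        filter_upwards [Filter.mem_cocompact.mpr ⟨{i}, isCompact_singleton, subset_rfl⟩] with j hj
        simp only [Set.mem_compl_iff, Set.mem_singleton_iff] at hj
        simp [hj]
      exact Filter.Tendsto.congr' h.symm tendsto_const_nhds }

/-- `X` satisfies the countable chain condition. -/
def CountableChainCondition (X : Type*) [TopologicalSpace X] : Prop :=
  ∀ 𝒰 : Set (Set X), (∀ U ∈ 𝒰, IsOpen U ∧ U.Nonempty) → 𝒰.Pairwise Disjoint → 𝒰.Countable

universe u


universe v

/-- Precomposition as a continuous linear map. -/
def pullCLM {A B : Type*} [TopologicalSpace A] [TopologicalSpace B] (j : C(A, B)) :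
    C(B, ℝ) →L[ℝ] C(A, ℝ) where
  toFun f := f.comp j
  map_add' _ _ := rfl
  map_smul' _ _ := rfl
  cont := ContinuousMap.continuous_precomp j

@[simp] lemma pullCLM_apply {A B : Type*} [TopologicalSpace A] [TopologicalSpace B] (j : C(A, B))
    (f : C(B, ℝ)) (x : A) : pullCLM j f x = f (j x) := rfl

lemma hasExt_empty {K : Type*} [TopologicalSpace K] : HasExtensionOperator (∅ : Set K) :=
  ⟨0, fun f => by ext x; exact x.2.elim⟩

lemma ep_any {K : Type*} [TopologicalSpace K] (h : HasExtensionProperty K) (F : Set K)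
    (hF : IsClosed F) : HasExtensionOperator F := by
  rcases F.eq_empty_or_nonempty with rfl | hne
  · exact hasExt_empty
  · exact h F hne hF

lemma ep_closed {K : Type*} [TopologicalSpace K] (h : HasExtensionProperty K) (F : Set K)
    (hF : IsClosed F) : HasExtensionProperty ↥F := by
  intro G _ hG
  have hG' : IsClosed ((↑) '' G : Set K) := hF.isClosedEmbedding_subtypeVal.isClosedMap _ hG
  obtain ⟨E, hE⟩ := ep_any h _ hG'
  have hj : ∀ y : ((↑) '' G : Set K), ∃ hy : (y : K) ∈ F, (⟨y, hy⟩ : F) ∈ G := by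
    rintro ⟨_, ⟨z, hz, rfl⟩⟩
    exact ⟨z.2, hz⟩
  let j : C(((↑) '' G : Set K), G) := ⟨fun y => ⟨⟨y, (hj y).1⟩, (hj y).2⟩, by fun_prop⟩
  let i : C(F, K) := ⟨Subtype.val, continuous_subtype_val⟩
  refine ⟨(pullCLM i).comp (E.comp (pullCLM j)), fun f => ?_⟩
  ext x
  have := congrArg (fun u => u (⟨x.1.1, ⟨x.1, x.2, rfl⟩⟩ : ((↑) '' G : Set K))) (hE (pullCLM j f))
  exact this

lemma step_ext {X L : Type*} [TopologicalSpace X] [CompactSpace X]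
    [TopologicalSpace L] [CompactSpace L] [T2Space L] (hX : HasExtensionProperty X)
    (φ : C(X, L)) (hφ : Function.Surjective φ) (D : Set L) (hD : IsClosed D)
    (hiso : ∀ x ∉ D, IsOpen ({x} : Set L)) : HasExtensionOperator D := by
  have : CompactSpace ↥D := isCompact_iff_compactSpace.mp hD.isCompact
  have hH : IsClosed (φ ⁻¹' D) := hD.preimage φ.continuous
  have : CompactSpace ↥(φ ⁻¹' D) := isCompact_iff_compactSpace.mp hH.isCompact
  obtain ⟨E, hE⟩ := ep_any hX _ hH
  choose s hs using hφ
  let r : C(↥(φ ⁻¹' D), D) := ⟨fun y => ⟨φ y, y.2⟩, by fun_prop⟩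
  let U : C(D, ℝ) →L[ℝ] C(X, ℝ) := E.comp (pullCLM r)
  have hU : ∀ (g : C(D, ℝ)) (y : X) (hy : φ y ∈ D), U g y = g ⟨φ y, hy⟩ := by
    intro g y hy
    exact congrArg (fun u => u (⟨y, hy⟩ : ↥(φ ⁻¹' D))) (hE (pullCLM r g))
  have hUs : ∀ (g : C(D, ℝ)) (p : L) (hp : p ∈ D), U g (s p) = g ⟨p, hp⟩ := by
    intro g p hp
    rw [hU g (s p) (by rw [hs]; exact hp)]
    congr 1
    exact Subtype.ext (hs p)
  have hcont : ∀ g, Continuous fun p => U g (s p) := by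
    intro g
    rw [continuous_iff_continuousAt]
    intro p
    by_cases hp : p ∈ D
    · rw [Metric.continuousAt_iff']
      intro ε hε
      have hZ : IsClosed {y : X | ε ≤ dist (U g y) (g ⟨p, hp⟩)} :=
        isClosed_le continuous_const (by fun_prop)
      have hφZ := (hZ.isCompact.image φ.continuous).isClosed
      have hpn : p ∉ φ '' {y : X | ε ≤ dist (U g y) (g ⟨p, hp⟩)} := by
        rintro ⟨y, hy, rfl⟩
        have := hU g y hp
        simp only [Set.mem_ofPred_eq, this, dist_self] at hy
        linarith
      filter_upwards [hφZ.isOpen_compl.mem_nhds hpn] with x hx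
      by_contra hcon
      rw [hUs g p hp] at hcon
      exact hx ⟨s x, not_lt.mp hcon, hs x⟩
    · have := (isOpen_singleton_iff_nhds_eq_pure p).1 (hiso p hp)
      rw [ContinuousAt, this]
      exact tendsto_pure_nhds _ _
  let V : C(D, ℝ) →ₗ[ℝ] C(L, ℝ) :=
    { toFun := fun g => ⟨fun p => U g (s p), hcont g⟩
      map_add' := fun a b => by ext p; simp
      map_smul' := fun a b => by ext p; simp }
  refine ⟨V.mkContinuous ‖U‖ ?_, ?_⟩
  · intro g
    rw [ContinuousMap.norm_le _ (by positivity)]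
    intro p
    exact ((U g).norm_coe_le_norm _).trans (U.le_opNorm g)
  · intro g
    ext p
    exact hUs g p p.2

lemma step_ep {L : Type*} [TopologicalSpace L] [CompactSpace L] [T2Space L]
    (D : Set L) (hD : IsClosed D)
    (hiso : ∀ x ∉ D, IsOpen ({x} : Set L)) (hext : HasExtensionOperator D)
    (hep : HasExtensionProperty ↥D) : HasExtensionProperty L := by
  classical
  intro G _ hG
  have : CompactSpace ↥D := isCompact_iff_compactSpace.mp hD.isCompact
  have : CompactSpace ↥G := isCompact_iff_compactSpace.mp hG.isCompact
  obtain ⟨E, hE⟩ := hext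
  obtain ⟨E1, hE1⟩ := ep_any hep ((↑) ⁻¹' G) (hG.preimage continuous_subtype_val)
  let r : C(↥((↑) ⁻¹' G : Set D), G) := ⟨fun y => ⟨y, y.2⟩, by fun_prop⟩
  let U : C(G, ℝ) →L[ℝ] C(L, ℝ) := E.comp (E1.comp (pullCLM r))
  have hU : ∀ (g : C(G, ℝ)) (p : L) (hp : p ∈ D) (hp' : p ∈ G), U g p = g ⟨p, hp'⟩ := by
    intro g p hp hp'
    have h1 : U g p = E1 (pullCLM r g) ⟨p, hp⟩ :=
      congrArg (fun u => u (⟨p, hp⟩ : D)) (hE (E1 (pullCLM r g)))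
    have h2 : E1 (pullCLM r g) ⟨p, hp⟩ = g ⟨p, hp'⟩ :=
      congrArg (fun u => u (⟨⟨p, hp⟩, hp'⟩ : ((↑) ⁻¹' G : Set D))) (hE1 (pullCLM r g))
    rw [h1, h2]
  let W : C(G, ℝ) → L → ℝ := fun g p => if hp : p ∈ G then g ⟨p, hp⟩ else U g p
  have hWG : ∀ g p (hp : p ∈ G), W g p = g ⟨p, hp⟩ := fun g p hp => dif_pos hp
  have hWn : ∀ g p (hp : p ∉ G), W g p = U g p := fun g p hp => dif_neg hp
  have hcont : ∀ g, Continuous (W g) := by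
    intro g
    rw [continuous_iff_continuousAt]
    intro p
    by_cases hp : p ∈ D
    · by_cases hp' : p ∈ G
      · rw [← continuousWithinAt_univ, ← Set.union_compl_self G, continuousWithinAt_union]
        constructor
        · rw [continuousWithinAt_iff_continuousAt_domRestrict _ hp']
          have : G.domRestrict (W g) = g := by
            ext x; exact hWG g x x.2
          rw [this]
          exact g.continuous.continuousAt
        · have h1 : ContinuousWithinAt (U g) Gᶜ p := (U g).continuous.continuousWithinAt
          refine h1.congr (fun y hy => hWn g y hy) ?_
          rw [hWG g p hp', hU g p hp hp']
      · refine (U g).continuous.continuousAt.congr ?_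
        filter_upwards [hG.isOpen_compl.mem_nhds hp'] with x hx
        exact (hWn g x hx).symm
    · have := (isOpen_singleton_iff_nhds_eq_pure p).1 (hiso p hp)
      rw [ContinuousAt, this]
      exact tendsto_pure_nhds _ _
  let V : C(G, ℝ) →ₗ[ℝ] C(L, ℝ) :=
    { toFun := fun g => ⟨W g, hcont g⟩
      map_add' := fun a b => by
        ext p
        by_cases hp : p ∈ G <;> simp [W, hp]
      map_smul' := fun a b => by
        ext p
        by_cases hp : p ∈ G <;> simp [W, hp] }
  refine ⟨V.mkContinuous (1 + ‖U‖) ?_, ?_⟩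
  · intro g
    rw [ContinuousMap.norm_le _ (by positivity)]
    intro p
    have h1 : 0 ≤ ‖U‖ * ‖g‖ := by positivity
    have h2 : 0 ≤ ‖g‖ := by positivity
    change ‖W g p‖ ≤ _
    by_cases hp : p ∈ G
    · rw [hWG g p hp]
      have := g.norm_coe_le_norm ⟨p, hp⟩
      linarith
    · rw [hWn g p hp]
      have := ((U g).norm_coe_le_norm p).trans (U.le_opNorm g)
      linarith
  · intro g
    ext p
    exact hWG g p p.2

lemma derived_sub {L : Type*} [TopologicalSpace L] (D : Set L) (hD : IsClosed D) (n : ℕ) :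
    derivedSet^[n] (Set.univ : Set D) = (↑) ⁻¹' (derivedSet^[n] D) ∧ derivedSet^[n] D ⊆ D := by
  induction n with
  | zero => simp
  | succ n ih =>
    rw [Function.iterate_succ_apply', Function.iterate_succ_apply', ih.1]
    refine ⟨?_, ?_⟩
    · ext x
      simp only [mem_derivedSet, Set.mem_preimage]
      rw [accPt_iff_nhds, accPt_iff_nhds]
      constructor
      · intro h U hU
        obtain ⟨y, hy, hne⟩ := h _ (continuous_subtype_val.continuousAt.preimage_mem_nhds hU)
        exact ⟨y, hy, fun h => hne (Subtype.ext h)⟩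
      · intro h U hU
        obtain ⟨V, hV, hVU⟩ := mem_nhds_subtype _ _ _ |>.1 hU
        obtain ⟨y, hy, hne⟩ := h V hV
        exact ⟨⟨y, ih.2 hy.2⟩, ⟨hVU hy.1, hy.2⟩, fun h => hne (congrArg Subtype.val h)⟩
    · exact (derivedSet_mono _ _ ih.2).trans ((isClosed_iff_derivedSet_subset D).1 hD)

lemma c0_finite {I : Type*} [TopologicalSpace I] [DiscreteTopology I] (f : C₀(I, ℝ)) {ε : ℝ}
    (hε : 0 < ε) : {i | ε ≤ ‖f i‖}.Finite := by
  have h := f.zero_at_infty'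
  rw [cocompact_eq_cofinite] at h
  have := h.eventually (Metric.ball_mem_nhds (0 : ℝ) hε)
  rw [eventually_cofinite] at this
  refine this.subset fun i hi => ?_
  have hi' : ε ≤ ‖f i‖ := hi
  intro hcon
  rw [dist_zero_right] at hcon
  exact absurd hcon (not_lt.2 hi')

/-- Element of `c₀` from a finiteness condition. -/
def c0mk {I : Type*} [TopologicalSpace I] [DiscreteTopology I] (f : I → ℝ)
    (h : ∀ ε > 0, {i | ε ≤ ‖f i‖}.Finite) : C₀(I, ℝ) where
  toFun := f
  continuous_toFun := continuous_of_discreteTopology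
  zero_at_infty' := by
    rw [cocompact_eq_cofinite, Metric.tendsto_nhds]
    intro ε hε
    rw [eventually_cofinite]
    refine (h ε hε).subset fun i hi => ?_
    simpa using hi

lemma c0_norm_le {I : Type*} [TopologicalSpace I] (f : C₀(I, ℝ)) {C : ℝ} (hC : 0 ≤ C)
    (h : ∀ i, ‖f i‖ ≤ C) : ‖f‖ ≤ C := by
  rw [← ZeroAtInftyContinuousMap.norm_toBCF_eq_norm]
  exact (BoundedContinuousFunction.norm_le hC).2 h

lemma c0_coe_le {I : Type*} [TopologicalSpace I] (f : C₀(I, ℝ)) (i : I) : ‖f i‖ ≤ ‖f‖ := by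
  rw [← ZeroAtInftyContinuousMap.norm_toBCF_eq_norm]
  exact f.toBCF.norm_coe_le_norm i

/-- Being isomorphic to some `c₀(I)`. -/
def IsC0 (L : Type u) [TopologicalSpace L] : Prop :=
  ∃ (I : Type u) (_ : TopologicalSpace I) (_ : DiscreteTopology I),
    Nonempty (C(L, ℝ) ≃L[ℝ] C₀(I, ℝ))

lemma step_c0 {L : Type u} [TopologicalSpace L] [CompactSpace L] [T2Space L]
    (D : Set L) (hD : IsClosed D)
    (hiso : ∀ x ∉ D, IsOpen ({x} : Set L)) (hext : HasExtensionOperator D)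
    (hc : IsC0 ↥D) : IsC0 L := by
  classical
  obtain ⟨I, _, _, ⟨A⟩⟩ := hc
  obtain ⟨E, hE⟩ := hext
  have : CompactSpace ↥D := isCompact_iff_compactSpace.mp hD.isCompact
  have hE' : ∀ (g : C(D, ℝ)) (p : L) (hp : p ∈ D), E g p = g ⟨p, hp⟩ := fun g p hp =>
    congrArg (fun u => u (⟨p, hp⟩ : D)) (hE g)
  have hdisc : DiscreteTopology ↥(Dᶜ) := by
    rw [discreteTopology_iff_isOpen_singleton]
    intro x
    convert! (hiso x x.2).preimage (continuous_subtype_val (p := fun y => y ∈ Dᶜ)) using 1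
    ext y
    simp [Subtype.ext_iff]
  let ρ : C(L, ℝ) →L[ℝ] C(D, ℝ) := pullCLM ⟨Subtype.val, continuous_subtype_val⟩
  have hρ : ∀ f p, ρ f p = f p := fun f p => rfl
  let Q : C(L, ℝ) →L[ℝ] C(L, ℝ) := ContinuousLinearMap.id ℝ _ - E.comp ρ
  have hQ : ∀ f p, Q f p = f p - E (ρ f) p := fun f p => rfl
  have hQD : ∀ f p, p ∈ D → Q f p = 0 := by
    intro f p hp
    rw [hQ, hE' _ p hp, hρ, sub_self]
  let w : C(L, ℝ) → I ⊕ ↥(Dᶜ) → ℝ := fun f => Sum.elim (A (ρ f)) (fun p => Q f p)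
  have hfin : ∀ f, ∀ ε > 0, {i | ε ≤ ‖w f i‖}.Finite := by
    intro f ε hε
    have h1 := (c0_finite (A (ρ f)) hε).image (Sum.inl : I → I ⊕ ↥(Dᶜ))
    have h2 : {p : ↥(Dᶜ) | ε ≤ ‖Q f p‖}.Finite := by
      have hcl : IsClosed {p : L | ε ≤ ‖Q f p‖} := isClosed_le continuous_const (by fun_prop)
      have hsub : {p : L | ε ≤ ‖Q f p‖} ⊆ Set.range (Subtype.val : ↥(Dᶜ) → L) := by
        intro p hp
        rw [Subtype.range_coe]
        intro hpD
        simp only [Set.mem_ofPred_eq, hQD f p hpD, norm_zero] at hp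
        linarith
      have : IsCompact ((Subtype.val : ↥(Dᶜ) → L) ⁻¹' {p : L | ε ≤ ‖Q f p‖}) :=
        (Topology.IsInducing.subtypeVal.isCompact_preimage_iff hsub).2 hcl.isCompact
      exact this.finite_of_discrete
    refine (h1.union (h2.image (Sum.inr : ↥(Dᶜ) → I ⊕ ↥(Dᶜ)))).subset ?_
    rintro (i | p) hi
    · exact Or.inl ⟨i, hi, rfl⟩
    · exact Or.inr ⟨p, hi, rfl⟩
  let V : C(L, ℝ) →ₗ[ℝ] C₀(I ⊕ ↥(Dᶜ), ℝ) :=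
    { toFun := fun f => c0mk (w f) (hfin f)
      map_add' := fun a b => by
        ext (i | p)
        · change A (ρ (a + b)) i = A (ρ a) i + A (ρ b) i
          rw [map_add, map_add]; rfl
        · change Q (a + b) p = Q a p + Q b p
          rw [map_add]; rfl
      map_smul' := fun c a => by
        ext (i | p)
        · change A (ρ (c • a)) i = c * A (ρ a) i
          rw [map_smul, map_smul]; rfl
        · change Q (c • a) p = c * Q a p
          rw [map_smul]; rfl }
  have hVl : ∀ f i, V f (Sum.inl i) = A (ρ f) i := fun f i => rfl
  have hVr : ∀ f p, V f (Sum.inr p) = Q f p := fun f i => rfl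
  let AR : C(L, ℝ) →L[ℝ] C₀(I, ℝ) := (A : C(D, ℝ) →L[ℝ] C₀(I, ℝ)).comp ρ
  let T : C(L, ℝ) →L[ℝ] C₀(I ⊕ ↥(Dᶜ), ℝ) := V.mkContinuous (‖AR‖ + ‖Q‖) (by
    intro f
    have h1 : 0 ≤ ‖AR‖ * ‖f‖ := by positivity
    have h2 : 0 ≤ ‖Q‖ * ‖f‖ := by positivity
    refine c0_norm_le _ (by positivity) ?_
    rintro (i | p)
    · have := (c0_coe_le (AR f) i).trans (AR.le_opNorm f)
      change ‖AR f i‖ ≤ _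
      linarith
    · have := ((Q f).norm_coe_le_norm p).trans (Q.le_opNorm f)
      change ‖Q f p‖ ≤ _
      linarith)
  have hT : ∀ f, T f = V f := fun f => rfl
  refine ⟨I ⊕ ↥(Dᶜ), inferInstance, inferInstance, ⟨ContinuousLinearEquiv.ofBijective T ?_ ?_⟩⟩
  · rw [LinearMap.ker_eq_bot']
    intro f hf
    have hf' : V f = 0 := hf
    have h1 : A (ρ f) = 0 := by
      ext i
      rw [← hVl, hf']; rfl
    have h2 : ρ f = 0 := by simpa using h1
    ext p
    by_cases hp : p ∈ D
    · have := hρ f ⟨p, hp⟩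
      rw [h2] at this
      exact this.symm
    · have := hVr f ⟨p, hp⟩
      rw [hf', hQ, h2] at this
      simpa using this.symm
  · rw [LinearMap.range_eq_top]
    intro z
    have ha : ∀ ε > 0, {i : I | ε ≤ ‖z (Sum.inl i)‖}.Finite := fun ε hε =>
      Set.Finite.preimage (f := Sum.inl) Sum.inl_injective.injOn (c0_finite z hε)
    let a : C₀(I, ℝ) := c0mk (fun i => z (Sum.inl i)) ha
    let b : L → ℝ := fun p => if hp : p ∈ D then 0 else z (Sum.inr ⟨p, hp⟩)
    have hb : Continuous b := by
      rw [continuous_iff_continuousAt]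
      intro p
      by_cases hp : p ∈ D
      · rw [Metric.continuousAt_iff']
        intro ε hε
        have hf : (Subtype.val '' {q : ↥(Dᶜ) | ε ≤ ‖z (Sum.inr q)‖}).Finite :=
          ((c0_finite z hε).preimage Sum.inr_injective.injOn).image _
        have hpn : p ∉ (Subtype.val '' {q : ↥(Dᶜ) | ε ≤ ‖z (Sum.inr q)‖}) := by
          rintro ⟨q, -, rfl⟩
          exact q.2 hp
        filter_upwards [hf.isClosed.isOpen_compl.mem_nhds hpn] with x hx
        have hbp : b p = 0 := dif_pos hp
        rw [hbp, dist_zero_right]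
        by_cases hxD : x ∈ D
        · have : b x = 0 := dif_pos hxD
          rw [this]; simpa using hε
        · have : b x = z (Sum.inr ⟨x, hxD⟩) := dif_neg hxD
          rw [this]
          by_contra hcon
          exact hx ⟨⟨x, hxD⟩, not_lt.mp hcon, rfl⟩
      · have := (isOpen_singleton_iff_nhds_eq_pure p).1 (hiso p hp)
        rw [ContinuousAt, this]
        exact tendsto_pure_nhds _ _
    let f : C(L, ℝ) := E (A.symm a) + ⟨b, hb⟩
    have hfp : ∀ p, f p = E (A.symm a) p + b p := fun p => rfl
    have hρf : ρ f = A.symm a := by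
      ext p
      have hbp : b p = 0 := dif_pos p.2
      rw [hρ, hfp, hE' _ p p.2, hbp, add_zero]
    refine ⟨f, ?_⟩
    change V f = z
    ext (i | p)
    · rw [hVl, hρf, A.apply_symm_apply]; rfl
    · have hbp : b p = z (Sum.inr p) := dif_neg p.2
      rw [hVr, hQ, hρf, hfp, hbp]; ring

lemma base_c0 (L : Type u) [TopologicalSpace L] [IsEmpty L] : IsC0 L := by
  refine ⟨PEmpty, ⊥, ⟨rfl⟩, ?_⟩
  letI : TopologicalSpace PEmpty.{u+1} := ⊥
  have h1 : Subsingleton C(L, ℝ) := ⟨fun a b => by ext x; exact isEmptyElim x⟩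
  have h2 : Subsingleton C₀(PEmpty.{u+1}, ℝ) := ⟨fun a b => by ext x; exact isEmptyElim x⟩
  exact ⟨{ toFun := 0, invFun := 0, map_add' := fun _ _ => Subsingleton.elim _ _,
           map_smul' := fun _ _ => Subsingleton.elim _ _,
           left_inv := fun _ => Subsingleton.elim _ _, right_inv := fun _ => Subsingleton.elim _ _,
           continuous_toFun := continuous_const, continuous_invFun := continuous_const }⟩

lemma main_ind (n : ℕ) : ∀ (L : Type u) [TopologicalSpace L] [CompactSpace L] [T2Space L]
    {X : Type v} [TopologicalSpace X] [CompactSpace X] (_ : HasExtensionProperty X)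
    (φ : C(X, L)) (_ : Function.Surjective φ)
    (_ : derivedSet^[n] (Set.univ : Set L) = ∅), HasExtensionProperty L ∧ IsC0 L := by
  induction n with
  | zero =>
    intro L _ _ _ X _ _ hX φ hφ h
    have : IsEmpty L := Set.univ_eq_empty_iff.1 h
    exact ⟨fun F hF => isEmptyElim hF.some, base_c0 L⟩
  | succ n ih =>
    intro L _ _ _ X _ _ hX φ hφ h
    let D : Set L := derivedSet Set.univ
    have hD : IsClosed D := isClosed_derivedSet _
    have : CompactSpace ↥D := isCompact_iff_compactSpace.mp hD.isCompact
    have hiso : ∀ x ∉ D, IsOpen ({x} : Set L) := by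
      intro x hx
      rw [isOpen_singleton_iff_punctured_nhds]
      simpa [D, AccPt, neBot_iff] using hx
    have hext := step_ext hX φ hφ D hD hiso
    have hH : IsClosed (φ ⁻¹' D) := hD.preimage φ.continuous
    have : CompactSpace ↥(φ ⁻¹' D) := isCompact_iff_compactSpace.mp hH.isCompact
    have hrec := ih ↥D (ep_closed hX _ hH) ⟨fun y => ⟨φ y, y.2⟩, by fun_prop⟩
      (by
        rintro ⟨p, hp⟩
        obtain ⟨y, rfl⟩ := hφ p
        exact ⟨⟨y, hp⟩, rfl⟩)
      (by
        rw [(derived_sub D hD n).1]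
        rw [Function.iterate_succ_apply] at h
        change _ ⁻¹' (derivedSet^[n] (derivedSet Set.univ)) = ∅
        rw [h]; rfl)
    exact ⟨step_ep D hD hiso hext hrec.1, step_c0 D hD hiso hext hrec.2⟩

lemma pm_aux {a b : ℝ} (h1 : |a| = 1) (h2 : |a + b| = 1) (h3 : |a - b| = 1) : b = 0 := by
  rcases abs_eq (zero_le_one) |>.1 h1 with h1 | h1 <;>
  rcases abs_eq (zero_le_one) |>.1 h2 with h2 | h2 <;>
  rcases abs_eq (zero_le_one) |>.1 h3 with h3 | h3 <;> linarith

/-- Holsztyński's theorem. -/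
lemma holsztynski {K L : Type*} [TopologicalSpace K] [CompactSpace K]
    [TopologicalSpace L] [CompactSpace L] [T2Space L] (T : C(L, ℝ) →ₗᵢ[ℝ] C(K, ℝ)) (x : L) :
    ∃ y : K, |T 1 y| = 1 ∧ ∀ f : C(L, ℝ), T f y = f x * T 1 y := by
  have hL : Nonempty L := ⟨x⟩
  have hne1 : ‖(1 : C(L, ℝ))‖ = 1 := norm_one
  have hKne : Nonempty K := by
    by_contra hK
    rw [not_nonempty_iff] at hK
    have : T 1 = 0 := by ext y; exact isEmptyElim y
    have h := T.norm_map 1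
    rw [this, hne1] at h
    simp at h
  -- the peak family
  let S := {f : C(L, ℝ) // ‖f‖ ≤ 1 ∧ f x = 1}
  have hle : ∀ (f : S) y, |T f.1 y| ≤ 1 := fun f y =>
    ((T f.1).norm_coe_le_norm y).trans ((T.norm_map f.1).le.trans f.2.1)
  have hinter : (⋂ f : S, {y : K | |T f.1 y| = 1}).Nonempty := by
    apply CompactSpace.iInter_nonempty
    · intro f
      exact isClosed_eq (by fun_prop) continuous_const
    · intro t
      let f : C(L, ℝ) := ∑ g ∈ t, g.1
      have hfx : f x = t.card := by
        simp only [f, ContinuousMap.coe_sum, Finset.sum_apply]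
        rw [Finset.sum_congr rfl (fun g _ => g.2.2)]
        simp
      obtain ⟨y, -, hy⟩ := isCompact_univ.exists_isMaxOn (Set.univ_nonempty (α := K))
        (f := fun y => ‖T f y‖) (by fun_prop)
      have hcard : (t.card : ℝ) ≤ ‖T f y‖ := by
        have h1 : ‖T f‖ ≤ ‖T f y‖ := by
          rw [ContinuousMap.norm_le _ (norm_nonneg _)]
          exact fun z => hy (Set.mem_univ z)
        have h2 := f.norm_coe_le_norm x
        rw [T.norm_map] at h1
        rw [hfx] at h2
        refine le_trans ?_ (h2.trans h1)
        exact le_abs_self _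
      have hTf : T f y = ∑ g ∈ t, T g.1 y := by
        simp only [f, map_sum, ContinuousMap.coe_sum, Finset.sum_apply]
      have hsum : ∑ g ∈ t, |T g.1 y| = ∑ g ∈ t, (1 : ℝ) := by
        apply le_antisymm (Finset.sum_le_sum fun g _ => hle g y)
        rw [hTf] at hcard
        simp only [Finset.sum_const, nsmul_eq_mul, mul_one]
        exact hcard.trans (Finset.abs_sum_le_sum_abs _ _)
      rw [Finset.sum_eq_sum_iff_of_le fun g _ => hle g y] at hsum
      refine ⟨y, ?_⟩
      simp only [Set.mem_iInter]
      exact hsum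
  obtain ⟨y, hy⟩ := hinter
  simp only [Set.mem_iInter, Set.mem_ofPred_eq] at hy
  have h1 : |T 1 y| = 1 := hy ⟨1, hne1.le, rfl⟩
  have key : ∀ f : C(L, ℝ), ‖f‖ ≤ 1 → f x = 0 → T f y = 0 := by
    intro f hf hfx
    have hb : ∀ p, |f p| ≤ 1 := fun p => (f.norm_coe_le_norm p).trans hf
    have hS : ∀ c : ℝ, |c| ≤ 1 → ‖(1 - |f|) + c • f‖ ≤ 1 ∧ ((1 - |f|) + c • f) x = 1 := by
      intro c hc
      refine ⟨?_, by simp [hfx]⟩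
      rw [ContinuousMap.norm_le _ zero_le_one]
      intro p
      have h2 : |c * f p| ≤ |f p| := by
        rw [abs_mul]
        exact mul_le_of_le_one_left (abs_nonneg _) hc
      have := hb p
      have h3 := abs_le.1 h2
      simp only [ContinuousMap.add_apply, ContinuousMap.sub_apply, ContinuousMap.one_apply,
        ContinuousMap.abs_apply, ContinuousMap.smul_apply, smul_eq_mul, Real.norm_eq_abs]
      rw [abs_le]
      constructor <;> linarith
    have e0 := hy ⟨_, hS 0 (by simp)⟩
    have e1 := hy ⟨_, hS 1 (by simp)⟩
    have e2 := hy ⟨_, hS (-1) (by simp)⟩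
    simp only [map_add, map_smul, zero_smul, add_zero, one_smul, neg_smul, map_neg,
      ContinuousMap.add_apply, ContinuousMap.neg_apply] at e0 e1 e2
    exact pm_aux e0 e1 (by rw [sub_eq_add_neg]; exact e2)
  have key2 : ∀ f : C(L, ℝ), f x = 0 → T f y = 0 := by
    intro f hfx
    have := key ((1 + ‖f‖)⁻¹ • f) (by
      rw [norm_smul, norm_inv, Real.norm_of_nonneg (by positivity), inv_mul_le_one₀ (by positivity)]
      linarith) (by simp [hfx])
    have hpos : (1 + ‖f‖) ≠ 0 := by positivity
    simpa [hpos] using this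
  refine ⟨y, h1, fun f => ?_⟩
  have := key2 (f - f x • 1) (by simp)
  rw [map_sub, map_smul] at this
  simp only [ContinuousMap.sub_apply, ContinuousMap.smul_apply, smul_eq_mul] at this
  linarith

theorem stmt14 {K : Type*} [TopologicalSpace K] [CompactSpace K] [T2Space K]
    {L : Type u} [TopologicalSpace L] [CompactSpace L] [T2Space L]
    (hK : HasExtensionProperty K)
    (hL : ∃ n : ℕ, derivedSet^[n] (Set.univ : Set L) = ∅)
    (hS : Nonempty (C(L, ℝ) →ₗᵢ[ℝ] C(K, ℝ))) :
    HasExtensionProperty L ∧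
      ∃ I : Type u, letI : TopologicalSpace I := ⊥
        Nonempty (C(L, ℝ) ≃L[ℝ] C₀(I, ℝ)) := by
  obtain ⟨n, hn⟩ := hL
  obtain ⟨T⟩ := hS
  let R : Set (K × L) := {q | |T 1 q.1| = 1 ∧ ∀ f : C(L, ℝ), T f q.1 = f q.2 * T 1 q.1}
  have hR : IsClosed R := by
    refine IsClosed.and (isClosed_eq (by fun_prop) continuous_const) ?_
    simp only [Set.ofPred_forall]
    exact isClosed_iInter fun f => isClosed_eq (by fun_prop) (by fun_prop)
  let F : Set K := Prod.fst '' R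
  have hF : IsClosed F := (hR.isCompact.image continuous_fst).isClosed
  have hφ : ∀ y : F, ∃ x : L, ((y : K), x) ∈ R := by
    rintro ⟨_, ⟨⟨y, x⟩, h, rfl⟩⟩
    exact ⟨x, h⟩
  have huniq : ∀ (y : K) (x x' : L), (y, x) ∈ R → (y, x') ∈ R → x = x' := by
    intro y x x' h h'
    by_contra hne
    have hcl : IsClosed ({x} : Set L) := isClosed_singleton
    obtain ⟨f, hf0, hf1, -⟩ := exists_continuous_zero_one_of_isClosed
      (isClosed_singleton (x := x)) (isClosed_singleton (x := x')) (by simpa using hne)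
    have e1 := h.2 f
    have e2 := h'.2 f
    have e3 := h.1
    have hx : f x = 0 := hf0 rfl
    have hx' : f x' = 1 := hf1 rfl
    simp only [hx, hx'] at e1 e2 e3
    rw [e1] at e2
    have : T 1 y = 0 := by linarith
    rw [this] at e3
    simp at e3
  choose φ hφR using hφ
  have hφc : Continuous φ := by
    rw [continuous_iff_isClosed]
    intro C hC
    have : φ ⁻¹' C = Subtype.val ⁻¹' (Prod.fst '' (R ∩ Prod.snd ⁻¹' C)) := by
      ext y
      constructor
      · intro hy
        exact ⟨(y, φ y), ⟨hφR y, hy⟩, rfl⟩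
      · rintro ⟨⟨y', x⟩, ⟨h1, h2⟩, h3⟩
        have h4 : y' = (y : K) := h3
        subst h4
        have := huniq _ _ _ h1 (hφR y)
        change φ y ∈ C
        rw [← this]
        exact h2
    rw [this]
    exact (((hR.inter (hC.preimage continuous_snd)).isCompact.image
      continuous_fst).isClosed).preimage continuous_subtype_val
  have : CompactSpace ↥F := isCompact_iff_compactSpace.mp hF.isCompact
  have hsurj : Function.Surjective φ := by
    intro x
    obtain ⟨y, hy⟩ := holsztynski T x
    have hyR : (y, x) ∈ R := hy
    exact ⟨⟨y, ⟨(y, x), hyR, rfl⟩⟩, huniq y _ _ (hφR ⟨y, ⟨(y, x), hyR, rfl⟩⟩) hyR⟩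
  obtain ⟨h1, I, t, d, h2⟩ := main_ind n L (ep_closed hK F hF) ⟨φ, hφc⟩ hsurj hn
  refine ⟨h1, I, ?_⟩
  obtain rfl : t = ⊥ := d.eq_bot
  exact h2
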